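/- arXiv:2405.03617 — 9 statements merged into one kernel-verified Lean document; each statement's English description precedes it below -/
import Mathlib

section
/- Let a, g : ℝ → ℝ be continuously differentiable, and define Φ(u) = 2·a(u)·g'(u) + a'(u)·g(u) and q(u) = g(u)·g'(u). Let u : ℝ × ℝ → ℝ be twice continuously differentiable and suppose that for all (x,t), u_t(x,t) = a(u(x,t))·u_x(x,t) + g(u(x,t)). Then u satisfies u_tt − a(u)²·u_xx = 2·a(u)·a'(u)·u_x² + Φ(u)·u_x + q(u) at every point (x,t). -/
/-- Partial derivative of `u(x,t)` with respect to the first argument `x`. -/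
noncomputable def px (u : ℝ × ℝ → ℝ) (p : ℝ × ℝ) : ℝ := fderiv ℝ u p (1, 0)

/-- Partial derivative of `u(x,t)` with respect to the second argument `t`. -/
noncomputable def pt (u : ℝ × ℝ → ℝ) (p : ℝ × ℝ) : ℝ := fderiv ℝ u p (0, 1)

/-- A directional derivative of a `C²` function is differentiable, with derivative given by the
second derivative of the function. -/
theorem hasFDerivAt_fderiv_apply {u : ℝ × ℝ → ℝ} (hu : ContDiff ℝ 2 u) (v p : ℝ × ℝ) :
    HasFDerivAt (fun y => fderiv ℝ u y v) ((fderiv ℝ (fderiv ℝ u) p).flip v) p := by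
  have h : HasFDerivAt (fderiv ℝ u) (fderiv ℝ (fderiv ℝ u) p) p :=
    ((hu.fderiv_right (m := 1) (by norm_num)).differentiable one_ne_zero p).hasFDerivAt
  exact ((ContinuousLinearMap.apply ℝ ℝ v).hasFDerivAt.comp p h).congr_fderiv (by ext <;> simp)

/-- Mixed second partial derivatives of a `C²` function commute. -/
theorem pt_px_eq_px_pt {u : ℝ × ℝ → ℝ} (hu : ContDiff ℝ 2 u) (p : ℝ × ℝ) :
    pt (px u) p = px (pt u) p := by
  have hx : fderiv ℝ (px u) p = _ := (hasFDerivAt_fderiv_apply hu (1, 0) p).fderiv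
  have ht : fderiv ℝ (pt u) p = _ := (hasFDerivAt_fderiv_apply hu (0, 1) p).fderiv
  have hsymm : IsSymmSndFDerivAt ℝ u p := hu.contDiffAt.isSymmSndFDerivAt (by simp)
  rw [pt, px, hx, ht]
  exact hsymm (0, 1) (1, 0)

/-- If `u_t = a(u)·u_x + g(u)`, with `Φ = 2ag' + a'g` and `q = gg'`, then
`u_tt − a(u)²·u_xx = 2·a(u)·a'(u)·u_x² + Φ(u)·u_x + q(u)`. -/
theorem wave_with_source_intermediate_integral
    (a g Φ q : ℝ → ℝ) (u : ℝ × ℝ → ℝ)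
    (ha : ContDiff ℝ 1 a) (hg : ContDiff ℝ 1 g) (hu : ContDiff ℝ 2 u)
    (hΦ : ∀ v : ℝ, Φ v = 2 * a v * deriv g v + deriv a v * g v)
    (hq : ∀ v : ℝ, q v = g v * deriv g v)
    (heq : ∀ x t : ℝ, pt u (x, t) = a (u (x, t)) * px u (x, t) + g (u (x, t))) :
    ∀ x t : ℝ,
      pt (pt u) (x, t) - (a (u (x, t)))^2 * px (px u) (x, t) =
        2 * a (u (x, t)) * deriv a (u (x, t)) * (px u (x, t))^2
          + Φ (u (x, t)) * px u (x, t) + q (u (x, t)) := by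
  intro x t
  set p : ℝ × ℝ := (x, t)
  have hfun : pt u = fun y => a (u y) * px u y + g (u y) := funext fun y => heq y.1 y.2
  have hu' : HasFDerivAt u (fderiv ℝ u p) p := (hu.differentiable two_ne_zero p).hasFDerivAt
  have ha' := ((ha.differentiable one_ne_zero (u p)).hasDerivAt).comp_hasFDerivAt p hu'
  have hg' := ((hg.differentiable one_ne_zero (u p)).hasDerivAt).comp_hasFDerivAt p hu'
  have hpx : HasFDerivAt (px u) (fderiv ℝ (px u) p) p :=
    (hasFDerivAt_fderiv_apply hu (1, 0) p).differentiableAt.hasFDerivAt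
  have hD : fderiv ℝ (pt u) p = a (u p) • fderiv ℝ (px u) p
      + px u p • deriv a (u p) • fderiv ℝ u p + deriv g (u p) • fderiv ℝ u p := by
    rw [hfun]
    exact ((ha'.mul hpx).add hg').fderiv
  have hD_apply : ∀ v, fderiv ℝ (pt u) p v = a (u p) * fderiv ℝ (px u) p v
      + px u p * (deriv a (u p) * fderiv ℝ u p v) + deriv g (u p) * fderiv ℝ u p v := by
    simp [hD]
  have hxt : px (pt u) p = a (u p) * px (px u) p
      + px u p * (deriv a (u p) * px u p) + deriv g (u p) * px u p := hD_apply (1, 0)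
  have htt : pt (pt u) p = a (u p) * pt (px u) p
      + px u p * (deriv a (u p) * pt u p) + deriv g (u p) * pt u p := hD_apply (0, 1)
  rw [htt, pt_px_eq_px_pt hu, hxt, show pt u p = _ from heq x t, hΦ, hq]
  ring
end

section
/- Let a : ℝ → ℝ be continuously differentiable with a(u) > 0 for all u, let k₀ ∈ ℝ, and let u : ℝ × ℝ → ℝ be twice continuously differentiable. Suppose that for all (x,t), u_t(x,t) = a(u(x,t))·u_x(x,t) + k₀/√(a(u(x,t))). Then u satisfies u_tt − a(u)²·u_xx = 2·a(u)·a'(u)·u_x² + (k₀²/2)·d/du(1/a)(u), i.e. u_tt − a(u)²·u_xx = 2·a(u)·a'(u)·u_x² − (k₀²/2)·a'(u)/a(u)², at every point (x,t). -/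
theorem contDiff_fderiv_apply {u : ℝ × ℝ → ℝ} (hu : ContDiff ℝ 2 u) (w : ℝ × ℝ) :
    ContDiff ℝ 1 fun p => fderiv ℝ u p w :=
  (hu.fderiv_right (m := 1) (by norm_num)).clm_apply contDiff_const

theorem hasDerivAt_const_div_sqrt_comp {a : ℝ → ℝ} {a' v : ℝ} (k : ℝ)
    (ha : HasDerivAt a a' v) (hv : 0 < a v) :
    HasDerivAt (fun y => k / √(a y)) (-(k * a') / (2 * a v * √(a v))) v := by
  have hs : √(a v) ≠ 0 := (Real.sqrt_pos.2 hv).ne'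
  refine ((hasDerivAt_const v k).div (ha.sqrt hv.ne') hs).congr_deriv ?_
  rw [Real.sq_sqrt hv.le]
  field_simp
  ring

/-- Chain rule for the right-hand side `a(u) w + k / √(a(u))`, along a direction `v`. -/
theorem fderiv_mul_add_div_sqrt_apply {a : ℝ → ℝ} {u w : ℝ × ℝ → ℝ} {p : ℝ × ℝ} (k : ℝ)
    (ha : DifferentiableAt ℝ a (u p)) (hpos : 0 < a (u p)) (hu : DifferentiableAt ℝ u p)
    (hw : DifferentiableAt ℝ w p) (v : ℝ × ℝ) :
    fderiv ℝ (fun q => a (u q) * w q + k / √(a (u q))) p v =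
      a (u p) * fderiv ℝ w p v + w p * (deriv a (u p) * fderiv ℝ u p v)
        + -(k * deriv a (u p)) / (2 * a (u p) * √(a (u p))) * fderiv ℝ u p v := by
  have h₁ := ha.hasDerivAt.comp_hasFDerivAt p hu.hasFDerivAt
  have h₂ := (hasDerivAt_const_div_sqrt_comp k ha.hasDerivAt hpos).comp_hasFDerivAt p
    hu.hasFDerivAt
  have h := ((h₁.mul hw.hasFDerivAt).add h₂).fderiv
  simpa [Function.comp_def, Pi.add_def, Pi.mul_def] using congrArg (fun L => L v) h

/-- If `u_t = a(u)·u_x + k₀/√(a(u))` with `a > 0`, then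
`u_tt − a(u)²·u_xx = 2·a(u)·a'(u)·u_x² − (k₀²/2)·a'(u)/a(u)²`. -/
theorem wave_with_sqrt_source_intermediate_integral
    (a : ℝ → ℝ) (k₀ : ℝ) (u : ℝ × ℝ → ℝ)
    (ha : ContDiff ℝ 1 a) (hapos : ∀ v : ℝ, 0 < a v) (hu : ContDiff ℝ 2 u)
    (heq : ∀ x t : ℝ, pt u (x, t) =
      a (u (x, t)) * px u (x, t) + k₀ / Real.sqrt (a (u (x, t)))) :
    ∀ x t : ℝ,
      pt (pt u) (x, t) - (a (u (x, t)))^2 * px (px u) (x, t) =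
        2 * a (u (x, t)) * deriv a (u (x, t)) * (px u (x, t))^2
          - (k₀^2 / 2) * deriv a (u (x, t)) / (a (u (x, t)))^2 := by
  intro x t
  have hfun : pt u = fun q => a (u q) * px u q + k₀ / √(a (u q)) := funext fun q => heq q.1 q.2
  have hpx : DifferentiableAt ℝ (px u) (x, t) :=
    (contDiff_fderiv_apply hu (1, 0)).differentiable (by norm_num) _
  have hF := fderiv_mul_add_div_sqrt_apply k₀ (ha.differentiable (by norm_num) (u (x, t)))
    (hapos _) (hu.differentiable (by norm_num) (x, t)) hpx
  rw [← hfun] at hF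
  have htt := hF (0, 1)
  have htx := hF (1, 0)
  change pt (pt u) (x, t) = a (u (x, t)) * pt (px u) (x, t) + px u (x, t) *
    (deriv a (u (x, t)) * pt u (x, t)) + _ * pt u (x, t) at htt
  change px (pt u) (x, t) = a (u (x, t)) * px (px u) (x, t) + px u (x, t) *
    (deriv a (u (x, t)) * px u (x, t)) + _ * px u (x, t) at htx
  rw [htt, pt_px_eq_px_pt hu, htx, heq x t]
  have hA := hapos (u (x, t))
  obtain ⟨s, hs, hsA⟩ : ∃ s, 0 < s ∧ a (u (x, t)) = s ^ 2 :=
    ⟨_, Real.sqrt_pos.2 hA, (Real.sq_sqrt hA.le).symm⟩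
  rw [hsA, Real.sqrt_sq hs.le]
  field_simp
  ring
end

section
/- Let c ≠ 0, let λ ∈ {c, −c}, let q₁ : ℝ → ℝ be continuously differentiable, and define q₂(x) = (λ/2)·q₁'(x) − q₁(x)²/4. Let γ : ℝ × ℝ → ℝ be continuously differentiable with γ_t(x,t) + λ·γ_x(x,t) = (q₁(x)/2)·γ(x,t) for all (x,t). If u : ℝ × ℝ → ℝ is twice continuously differentiable and satisfies u_t(x,t) = λ·u_x(x,t) + (q₁(x)/2)·u(x,t) + γ(x,t) for all (x,t), then u satisfies the linear hyperbolic equation u_tt = c²·u_xx + q₁(x)·u_t + q₂(x)·u at every point (x,t). -/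
/-- Directional derivative of the right-hand side of a first-order equation
`l w + (q(x)/2) u + g`. -/
theorem fderiv_first_order_rhs_apply {q : ℝ → ℝ} {w u g : ℝ × ℝ → ℝ} {p : ℝ × ℝ} (l : ℝ)
    (hq : DifferentiableAt ℝ q p.1) (hw : DifferentiableAt ℝ w p)
    (hu : DifferentiableAt ℝ u p) (hg : DifferentiableAt ℝ g p) (v : ℝ × ℝ) :
    fderiv ℝ (fun p => l * w p + (q p.1 / 2) * u p + g p) p v =
      l * fderiv ℝ w p v + (deriv q p.1 * v.1 / 2) * u p + (q p.1 / 2) * fderiv ℝ u p v +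
        fderiv ℝ g p v := by
  have hq' : HasFDerivAt (fun p : ℝ × ℝ => q p.1 / 2)
      ((1 / 2 : ℝ) • deriv q p.1 • ContinuousLinearMap.fst ℝ ℝ ℝ) p := by
    refine ((hq.hasDerivAt.comp_hasFDerivAt p
      (ContinuousLinearMap.fst ℝ ℝ ℝ).hasFDerivAt).const_mul (1 / 2 : ℝ)).congr_of_eventuallyEq
      (.of_forall fun p => ?_)
    change q p.1 / 2 = 1 / 2 * q p.1
    ring
  have h := ((hw.hasFDerivAt.const_mul l).add (hq'.mul hu.hasFDerivAt)).add hg.hasFDerivAt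
  have h' : HasFDerivAt (fun p => l * w p + (q p.1 / 2) * u p + g p) _ p := h
  rw [h'.fderiv]
  simp
  ring

/-- With `λ ∈ {c, −c}`, `q₂ = (λ/2)q₁' − q₁²/4`, `γ_t + λγ_x = (q₁/2)γ`: any `u` with
`u_t = λu_x + (q₁/2)u + γ` solves `u_tt = c²u_xx + q₁u_t + q₂u`. -/
theorem telegraph_type_intermediate_integral
    (c lam : ℝ) (hc : c ≠ 0) (hlam : lam = c ∨ lam = -c)
    (q₁ q₂ : ℝ → ℝ) (hq₁ : ContDiff ℝ 1 q₁)
    (hq₂ : ∀ x : ℝ, q₂ x = (lam / 2) * deriv q₁ x - (q₁ x)^2 / 4)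
    (γ : ℝ × ℝ → ℝ) (hγ : ContDiff ℝ 1 γ)
    (hγeq : ∀ x t : ℝ, pt γ (x, t) + lam * px γ (x, t) = (q₁ x / 2) * γ (x, t))
    (u : ℝ × ℝ → ℝ) (hu : ContDiff ℝ 2 u)
    (heq : ∀ x t : ℝ, pt u (x, t) =
      lam * px u (x, t) + (q₁ x / 2) * u (x, t) + γ (x, t)) :
    ∀ x t : ℝ,
      pt (pt u) (x, t) =
        c^2 * px (px u) (x, t) + q₁ x * pt u (x, t) + q₂ x * u (x, t) := by
  intro x t
  have hfun : pt u = fun p => lam * px u p + (q₁ p.1 / 2) * u p + γ p :=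
    funext fun p => heq p.1 p.2
  have hpx : DifferentiableAt ℝ (px u) (x, t) :=
    (((hu.fderiv_right (m := 1) (by norm_num)).clm_apply contDiff_const).differentiable
      (by norm_num)) (x, t)
  have hrhs := fderiv_first_order_rhs_apply (p := (x, t)) lam
    (hq₁.differentiable (by norm_num) x) hpx (hu.differentiable (by norm_num) (x, t))
    (hγ.differentiable (by norm_num) (x, t))
  have htt : pt (pt u) (x, t) =
      lam * pt (px u) (x, t) + (q₁ x / 2) * pt u (x, t) + pt γ (x, t) := by
    have h := hrhs (0, 1)
    rw [← hfun] at h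
    simpa [pt] using h
  have hxt : px (pt u) (x, t) = lam * px (px u) (x, t) + (deriv q₁ x / 2) * u (x, t) +
      (q₁ x / 2) * px u (x, t) + px γ (x, t) := by
    have h := hrhs (1, 0)
    rw [← hfun] at h
    simpa [px] using h
  have hsq : lam ^ 2 = c ^ 2 := sq_eq_sq_iff_eq_or_eq_neg.mpr hlam
  rw [htt, pt_px_eq_px_pt hu, hxt, hq₂, ← hsq]
  linear_combination hγeq x t - (q₁ x / 2) * heq x t
end

section
/- Let c ≠ 0, let q₁ : ℝ → ℝ be continuously differentiable, define q₂(x) = −(c/2)·q₁'(x) − q₁(x)²/4, and let Q : ℝ → ℝ satisfy Q'(x) = q₁(x)/(2c). Then for every twice continuously differentiable F : ℝ → ℝ, the function u(x,t) = F(x − ct)·e^{Q(x)} satisfies u_tt = c²·u_xx + q₁(x)·u_t + q₂(x)·u at every point (x,t) ∈ ℝ × ℝ. -/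
/-- Total derivative of a right-moving profile times a function of `x`. -/
theorem hasFDerivAt_rightMoving_mul {f g : ℝ → ℝ} {f' g' c : ℝ} {p : ℝ × ℝ}
    (hf : HasDerivAt f f' (p.1 - c * p.2)) (hg : HasDerivAt g g' p.1) :
    HasFDerivAt (fun p : ℝ × ℝ => f (p.1 - c * p.2) * g p.1)
      (f (p.1 - c * p.2) • (g' • ContinuousLinearMap.fst ℝ ℝ ℝ) +
        g p.1 • (f' • (ContinuousLinearMap.fst ℝ ℝ ℝ - c • ContinuousLinearMap.snd ℝ ℝ ℝ))) p :=
  (hf.comp_hasFDerivAt p (hasFDerivAt_fst.sub (hasFDerivAt_snd.const_mul c))).mul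
    (hg.comp_hasFDerivAt p hasFDerivAt_fst)

/-- With `q₂ = −(c/2)q₁' − q₁²/4` and `Q' = q₁/(2c)`, the function
`u(x,t) = F(x − ct)·e^{Q(x)}` solves `u_tt = c²u_xx + q₁u_t + q₂u`. -/
theorem right_moving_solution_telegraph_type
    (c : ℝ) (hc : c ≠ 0) (q₁ q₂ Q : ℝ → ℝ) (hq₁ : ContDiff ℝ 1 q₁)
    (hq₂ : ∀ x : ℝ, q₂ x = -(c / 2) * deriv q₁ x - (q₁ x)^2 / 4)
    (hQ : ∀ x : ℝ, HasDerivAt Q (q₁ x / (2 * c)) x)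
    (F : ℝ → ℝ) (hF : ContDiff ℝ 2 F)
    (u : ℝ × ℝ → ℝ)
    (hu : ∀ x t : ℝ, u (x, t) = F (x - c * t) * Real.exp (Q x)) :
    ∀ x t : ℝ,
      pt (pt u) (x, t) =
        c^2 * px (px u) (x, t) + q₁ x * pt u (x, t) + q₂ x * u (x, t) := by
  obtain rfl : u = fun p => F (p.1 - c * p.2) * Real.exp (Q p.1) := funext fun p => hu p.1 p.2
  have hF₁ (y : ℝ) : HasDerivAt F (deriv F y) y :=
    (hF.differentiable (by norm_num) y).hasDerivAt
  have hF₂ (y : ℝ) : HasDerivAt (deriv F) (deriv (deriv F) y) y :=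
    ((hF.deriv' (n := 1)).differentiable (by norm_num) y).hasDerivAt
  have hq (x : ℝ) : HasDerivAt q₁ (deriv q₁ x) x :=
    (hq₁.differentiable (by norm_num) x).hasDerivAt
  have hE (x : ℝ) := (hQ x).exp
  have hE' (x : ℝ) := (hE x).mul ((hq x).div_const (2 * c))
  have hpx : px (fun p => F (p.1 - c * p.2) * Real.exp (Q p.1)) = fun p =>
      deriv F (p.1 - c * p.2) * Real.exp (Q p.1) +
        F (p.1 - c * p.2) * (Real.exp (Q p.1) * (q₁ p.1 / (2 * c))) := by
    funext p
    rw [px, (hasFDerivAt_rightMoving_mul (hF₁ _) (hE _)).fderiv]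
    simp
    ring
  have hpt : pt (fun p => F (p.1 - c * p.2) * Real.exp (Q p.1)) = fun p =>
      deriv F (p.1 - c * p.2) * (-c * Real.exp (Q p.1)) := by
    funext p
    rw [pt, (hasFDerivAt_rightMoving_mul (hF₁ _) (hE _)).fderiv]
    simp
    ring
  intro x t
  have hxx := ((hasFDerivAt_rightMoving_mul (p := (x, t)) (hF₂ (x - c * t)) (hE x)).add
    (hasFDerivAt_rightMoving_mul (p := (x, t)) (hF₁ (x - c * t)) (hE' x))).fderiv
  have htt := (hasFDerivAt_rightMoving_mul (p := (x, t)) (hF₂ (x - c * t))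
    ((hE x).const_mul (-c))).fderiv
  have hpxx := (congrArg (fun w => px w (x, t)) hpx).trans
    (congrArg (fun L : ℝ × ℝ →L[ℝ] ℝ => L (1, 0)) hxx)
  have hptt := (congrArg (fun w => pt w (x, t)) hpt).trans
    (congrArg (fun L : ℝ × ℝ →L[ℝ] ℝ => L (0, 1)) htt)
  beta_reduce at hpxx hptt
  rw [hpxx, hptt, hpt, hq₂]
  simp
  field_simp
  ring
end

section
/- Let c ≠ 0, let q₁ : ℝ → ℝ be continuously differentiable, define q₂(x) = (c/2)·q₁'(x) − q₁(x)²/4, and let Q : ℝ → ℝ satisfy Q'(x) = q₁(x)/(2c). Then for every twice continuously differentiable F : ℝ → ℝ, the function u(x,t) = F(x + ct)·e^{−Q(x)} satisfies u_tt = c²·u_xx + q₁(x)·u_t + q₂(x)·u at every point (x,t) ∈ ℝ × ℝ. -/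
theorem hasFDerivAt_travelling_wave_mul {c G' H' : ℝ} {G H : ℝ → ℝ} {p : ℝ × ℝ}
    (hG : HasDerivAt G G' (p.1 + c * p.2)) (hH : HasDerivAt H H' p.1) :
    HasFDerivAt (fun p : ℝ × ℝ => G (p.1 + c * p.2) * H p.1)
      (G (p.1 + c * p.2) • H' • ContinuousLinearMap.fst ℝ ℝ ℝ +
        H p.1 • G' • (ContinuousLinearMap.fst ℝ ℝ ℝ + c • ContinuousLinearMap.snd ℝ ℝ ℝ)) p := by
  have hphase : HasFDerivAt (fun p : ℝ × ℝ => p.1 + c * p.2)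
      (ContinuousLinearMap.fst ℝ ℝ ℝ + c • ContinuousLinearMap.snd ℝ ℝ ℝ) p :=
    hasFDerivAt_fst.add (hasFDerivAt_snd.const_mul c)
  exact (hG.comp_hasFDerivAt p hphase).mul (hH.comp_hasFDerivAt p hasFDerivAt_fst)

theorem px_travelling_wave_mul {c G' H' : ℝ} {G H : ℝ → ℝ} {p : ℝ × ℝ}
    (hG : HasDerivAt G G' (p.1 + c * p.2)) (hH : HasDerivAt H H' p.1) :
    px (fun p => G (p.1 + c * p.2) * H p.1) p = G' * H p.1 + G (p.1 + c * p.2) * H' := by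
  rw [px, (hasFDerivAt_travelling_wave_mul hG hH).fderiv]
  simp
  ring

theorem pt_travelling_wave_mul {c G' H' : ℝ} {G H : ℝ → ℝ} {p : ℝ × ℝ}
    (hG : HasDerivAt G G' (p.1 + c * p.2)) (hH : HasDerivAt H H' p.1) :
    pt (fun p => G (p.1 + c * p.2) * H p.1) p = c * G' * H p.1 := by
  rw [pt, (hasFDerivAt_travelling_wave_mul hG hH).fderiv]
  simp
  ring

theorem px_add {u v : ℝ × ℝ → ℝ} {p : ℝ × ℝ} (hu : DifferentiableAt ℝ u p)
    (hv : DifferentiableAt ℝ v p) : px (fun p => u p + v p) p = px u p + px v p := by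
  simp [px, fderiv_fun_add hu hv]

/-- With `q₂ = (c/2)q₁' − q₁²/4` and `Q' = q₁/(2c)`, the function
`u(x,t) = F(x + ct)·e^{−Q(x)}` solves `u_tt = c²u_xx + q₁u_t + q₂u`. -/
theorem left_moving_solution_telegraph_type
    (c : ℝ) (hc : c ≠ 0) (q₁ q₂ Q : ℝ → ℝ) (hq₁ : ContDiff ℝ 1 q₁)
    (hq₂ : ∀ x : ℝ, q₂ x = (c / 2) * deriv q₁ x - (q₁ x)^2 / 4)
    (hQ : ∀ x : ℝ, HasDerivAt Q (q₁ x / (2 * c)) x)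
    (F : ℝ → ℝ) (hF : ContDiff ℝ 2 F)
    (u : ℝ × ℝ → ℝ)
    (hu : ∀ x t : ℝ, u (x, t) = F (x + c * t) * Real.exp (-Q x)) :
    ∀ x t : ℝ,
      pt (pt u) (x, t) =
        c^2 * px (px u) (x, t) + q₁ x * pt u (x, t) + q₂ x * u (x, t) := by
  intro x t
  have hF₁ (y : ℝ) : HasDerivAt F (deriv F y) y :=
    (hF.differentiable (by norm_num)).differentiableAt.hasDerivAt
  have hF₂ (y : ℝ) : HasDerivAt (deriv F) (deriv (deriv F) y) y :=
    hF.differentiable_deriv_two.differentiableAt.hasDerivAt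
  have hq (y : ℝ) : HasDerivAt q₁ (deriv q₁ y) y :=
    (hq₁.differentiable (by norm_num)).differentiableAt.hasDerivAt
  set E : ℝ → ℝ := fun y => Real.exp (-Q y)
  set E₁ : ℝ → ℝ := fun y => E y * -(q₁ y / (2 * c))
  have hE (y : ℝ) : HasDerivAt E (E₁ y) y := (hQ y).neg.exp
  have hE₁ (y : ℝ) :
      HasDerivAt E₁ (E₁ y * -(q₁ y / (2 * c)) + E y * -(deriv q₁ y / (2 * c))) y :=
    (hE y).mul ((hq y).div_const (2 * c)).neg
  have hu' : u = fun p => F (p.1 + c * p.2) * E p.1 := funext fun p => hu p.1 p.2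
  have hpt : pt u = fun p => (fun y => c * deriv F y) (p.1 + c * p.2) * E p.1 := by
    rw [hu']
    exact funext fun p => pt_travelling_wave_mul (hF₁ _) (hE _)
  have hpx : px u = fun p =>
      deriv F (p.1 + c * p.2) * E p.1 + F (p.1 + c * p.2) * E₁ p.1 := by
    rw [hu']
    exact funext fun p => px_travelling_wave_mul (hF₁ _) (hE _)
  rw [hpt, pt_travelling_wave_mul ((hF₂ _).const_mul c) (hE _), hpx,
    px_add (hasFDerivAt_travelling_wave_mul (hF₂ _) (hE _)).differentiableAt
      (hasFDerivAt_travelling_wave_mul (hF₁ _) (hE₁ _)).differentiableAt,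
    px_travelling_wave_mul (hF₂ _) (hE _), px_travelling_wave_mul (hF₁ _) (hE₁ _), hq₂, hu']
  simp only [E₁]
  field_simp
  ring
end

section
/- Let c ≠ 0 and q₁ ∈ ℝ be constants. Then for all twice continuously differentiable F, G : ℝ → ℝ, the function u(x,t) = F(x + ct)·e^{−(q₁/(4c))·(x − ct)} + G(x − ct)·e^{(q₁/(4c))·(x + ct)} satisfies the telegraph-type equation u_tt = c²·u_xx + q₁·u_t − (q₁²/4)·u at every point (x,t) ∈ ℝ × ℝ. -/
/-- The elementary wave `f(x + bt)e^{k(x − bt)}`. -/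
noncomputable def dampedWave (f : ℝ → ℝ) (b k : ℝ) (p : ℝ × ℝ) : ℝ :=
  f (p.1 + b * p.2) * Real.exp (k * (p.1 - b * p.2))

theorem hasFDerivAt_dampedWave {f : ℝ → ℝ} (hf : Differentiable ℝ f) (b k : ℝ) (p : ℝ × ℝ) :
    HasFDerivAt (dampedWave f b k)
      (dampedWave (fun s => deriv f s + k * f s) b k p • ContinuousLinearMap.fst ℝ ℝ ℝ
        + dampedWave (fun s => b * deriv f s - k * b * f s) b k p •
          ContinuousLinearMap.snd ℝ ℝ ℝ) p := by
  have h₁ : HasFDerivAt (fun p : ℝ × ℝ => p.1) (ContinuousLinearMap.fst ℝ ℝ ℝ) p :=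
    hasFDerivAt_fst
  have h₂ : HasFDerivAt (fun p : ℝ × ℝ => p.2) (ContinuousLinearMap.snd ℝ ℝ ℝ) p :=
    hasFDerivAt_snd
  have hfp := (hf (p.1 + b * p.2)).hasDerivAt.comp_hasFDerivAt p (h₁.add (h₂.const_mul b))
  have he := ((h₁.sub (h₂.const_mul b)).const_mul k).exp
  refine (hfp.mul he).congr_fderiv ?_
  ext <;> simp [dampedWave] <;> ring

theorem px_dampedWave_add {f g : ℝ → ℝ} (hf : Differentiable ℝ f) (hg : Differentiable ℝ g)
    (b k b' k' : ℝ) :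
    px (dampedWave f b k + dampedWave g b' k') =
      dampedWave (fun s => deriv f s + k * f s) b k
        + dampedWave (fun s => deriv g s + k' * g s) b' k' := by
  funext p
  simp [px, ((hasFDerivAt_dampedWave hf b k p).add (hasFDerivAt_dampedWave hg b' k' p)).fderiv]

theorem pt_dampedWave_add {f g : ℝ → ℝ} (hf : Differentiable ℝ f) (hg : Differentiable ℝ g)
    (b k b' k' : ℝ) :
    pt (dampedWave f b k + dampedWave g b' k') =
      dampedWave (fun s => b * deriv f s - k * b * f s) b k
        + dampedWave (fun s => b' * deriv g s - k' * b' * g s) b' k' := by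
  funext p
  simp [pt, ((hasFDerivAt_dampedWave hf b k p).add (hasFDerivAt_dampedWave hg b' k' p)).fderiv]

/-- General solution of the telegraph equation `u_tt = c²u_xx + q₁u_t − (q₁²/4)u`:
`u(x,t) = F(x + ct)e^{−(q₁/(4c))(x − ct)} + G(x − ct)e^{(q₁/(4c))(x + ct)}`. -/
theorem telegraph_general_solution
    (c q₁ : ℝ) (hc : c ≠ 0)
    (F G : ℝ → ℝ) (hF : ContDiff ℝ 2 F) (hG : ContDiff ℝ 2 G)
    (u : ℝ × ℝ → ℝ)
    (hu : ∀ x t : ℝ, u (x, t) =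
      F (x + c * t) * Real.exp (-(q₁ / (4 * c)) * (x - c * t))
        + G (x - c * t) * Real.exp ((q₁ / (4 * c)) * (x + c * t))) :
    ∀ x t : ℝ,
      pt (pt u) (x, t) =
        c^2 * px (px u) (x, t) + q₁ * pt u (x, t) - (q₁^2 / 4) * u (x, t) := by
  intro x t
  have hu' : u = dampedWave F c (-(q₁ / (4 * c))) + dampedWave G (-c) (q₁ / (4 * c)) := by
    funext ⟨x, t⟩
    simp [hu, dampedWave, sub_eq_add_neg]
  have hF₁ : Differentiable ℝ F := hF.differentiable (by norm_num)
  have hG₁ : Differentiable ℝ G := hG.differentiable (by norm_num)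
  have hF₂ : Differentiable ℝ (deriv F) := hF.differentiable_deriv_two
  have hG₂ : Differentiable ℝ (deriv G) := hG.differentiable_deriv_two
  have deriv_comb {f : ℝ → ℝ} (h₁ : Differentiable ℝ f) (h₂ : Differentiable ℝ (deriv f))
      (m n s : ℝ) :
      deriv (fun s => m * deriv f s - n * f s) s = m * deriv (deriv f) s - n * deriv f s :=
    (((h₂ s).hasDerivAt.const_mul m).sub ((h₁ s).hasDerivAt.const_mul n)).deriv
  have deriv_comb' {f : ℝ → ℝ} (h₁ : Differentiable ℝ f) (h₂ : Differentiable ℝ (deriv f))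
      (n s : ℝ) :
      deriv (fun s => deriv f s + n * f s) s = deriv (deriv f) s + n * deriv f s :=
    ((h₂ s).hasDerivAt.add ((h₁ s).hasDerivAt.const_mul n)).deriv
  rw [hu', pt_dampedWave_add hF₁ hG₁, px_dampedWave_add hF₁ hG₁,
    pt_dampedWave_add (by fun_prop) (by fun_prop), px_dampedWave_add (by fun_prop) (by fun_prop)]
  simp only [deriv_comb hF₁ hF₂, deriv_comb hG₁ hG₂, deriv_comb' hF₁ hF₂, deriv_comb' hG₁ hG₂,
    dampedWave, Pi.add_apply]
  obtain ⟨k, rfl⟩ : ∃ k, q₁ = 4 * c * k := ⟨q₁ / (4 * c), by field_simp⟩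
  rw [mul_div_cancel_left₀ k (by simpa using hc)]
  ring
end

section
/- Let I ⊆ ℝ be an open interval, let a : I → ℝ be twice continuously differentiable with a(x) > 0 on I, let φ : I → ℝ satisfy φ'(x) = a(x)^{-1/2} on I, and define c(x) = −a''(x)/4 + a'(x)²/(16·a(x)). Then for all twice continuously differentiable F, G : ℝ → ℝ, the function u(x,t) = a(x)^{-1/4}·( F(t − φ(x)) + G(t + φ(x)) ) satisfies the equation u_tt − a(x)·u_xx = a'(x)·u_x − c(x)·u at every point (x,t) ∈ I × ℝ. -/
/-- The derivative of an amplitude `A(x)` times a travelling profile `P(t + ψ(x))`. -/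
theorem hasFDerivAt_amplitude_mul_profile {A P ψ : ℝ → ℝ} {A' P' ψ' x t : ℝ}
    (hA : HasDerivAt A A' x) (hψ : HasDerivAt ψ ψ' x) (hP : HasDerivAt P P' (t + ψ x)) :
    HasFDerivAt (fun p : ℝ × ℝ => A p.1 * P (p.2 + ψ p.1))
      ((A' * P (t + ψ x) + A x * ψ' * P') • ContinuousLinearMap.fst ℝ ℝ ℝ +
        (A x * P') • ContinuousLinearMap.snd ℝ ℝ ℝ) (x, t) := by
  have h1 : HasFDerivAt (fun p : ℝ × ℝ => p.1) (ContinuousLinearMap.fst ℝ ℝ ℝ) (x, t) :=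
    hasFDerivAt_fst
  have h2 : HasFDerivAt (fun p : ℝ × ℝ => p.2) (ContinuousLinearMap.snd ℝ ℝ ℝ) (x, t) :=
    hasFDerivAt_snd
  have hA1 := HasDerivAt.comp_hasFDerivAt (x, t) (h₂ := A) hA h1
  have hψ1 := HasDerivAt.comp_hasFDerivAt (x, t) (h₂ := ψ) hψ h1
  have hP1 := HasDerivAt.comp_hasFDerivAt (x, t) (h₂ := P) hP (h2.add hψ1)
  refine (hA1.mul hP1).congr_fderiv ?_
  ext <;> simp
  ring

/-- Partial derivatives on the open strip `I × ℝ` may be read off from the Fréchet derivative of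
any function that agrees with `u` there. -/
theorem HasFDerivAt.px_pt_eq {u v : ℝ × ℝ → ℝ} {I : Set ℝ} (hI : IsOpen I)
    (huv : ∀ x ∈ I, ∀ t : ℝ, u (x, t) = v (x, t)) {x t α β : ℝ} (hx : x ∈ I)
    (hv : HasFDerivAt v (α • ContinuousLinearMap.fst ℝ ℝ ℝ + β • ContinuousLinearMap.snd ℝ ℝ ℝ)
      (x, t)) :
    px u (x, t) = α ∧ pt u (x, t) = β := by
  have hev : u =ᶠ[nhds (x, t)] v := by
    filter_upwards [(hI.preimage continuous_fst).mem_nhds (x := (x, t)) hx] with p hp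
    exact huv p.1 hp p.2
  have h := (hv.congr_of_eventuallyEq hev).fderiv
  simp [px, pt, h]

theorem HasFDerivAt.add_fst_snd {v w : ℝ × ℝ → ℝ} {p : ℝ × ℝ} {α β γ δ : ℝ}
    (hv : HasFDerivAt v (α • ContinuousLinearMap.fst ℝ ℝ ℝ + β • ContinuousLinearMap.snd ℝ ℝ ℝ) p)
    (hw : HasFDerivAt w (γ • ContinuousLinearMap.fst ℝ ℝ ℝ + δ • ContinuousLinearMap.snd ℝ ℝ ℝ)
      p) :
    HasFDerivAt (fun q => v q + w q)
      ((α + γ) • ContinuousLinearMap.fst ℝ ℝ ℝ + (β + δ) • ContinuousLinearMap.snd ℝ ℝ ℝ) p := by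
  refine (hv.add hw).congr_fderiv ?_
  module

/-- A twice continuously differentiable function on an open set has a derivative, which is itself
differentiable. -/
theorem ContDiffOn.hasDerivAt_and_hasDerivAt_deriv {f : ℝ → ℝ} {s : Set ℝ}
    (hf : ContDiffOn ℝ 2 f s) (hs : IsOpen s) {x : ℝ} (hx : x ∈ s) :
    HasDerivAt f (deriv f x) x ∧ HasDerivAt (deriv f) (deriv (deriv f) x) x := by
  have h1 : ContDiffOn ℝ 1 (deriv f) s := hf.deriv_of_isOpen hs (by norm_num)
  exact ⟨((hf.differentiableOn (by norm_num)).differentiableAt (hs.mem_nhds hx)).hasDerivAt,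
    ((h1.differentiableOn (by norm_num)).differentiableAt (hs.mem_nhds hx)).hasDerivAt⟩

theorem HasDerivAt.rpow_neg_quarter {a : ℝ → ℝ} {a' x : ℝ} (ha : HasDerivAt a a' x)
    (hpos : 0 < a x) :
    HasDerivAt (fun y => a y ^ (-(1/4 : ℝ))) (-(1/4) * a' * (a x ^ (-(1/4 : ℝ))) ^ 5) x := by
  have h := ha.rpow_const (p := -(1/4 : ℝ)) (Or.inl hpos.ne')
  refine h.congr_deriv ?_
  rw [← Real.rpow_natCast, ← Real.rpow_mul hpos.le, mul_comm a']
  norm_num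

/-- With `a > 0` on an open interval `I`, `φ' = a^{-1/2}` and
`c = −a''/4 + a'²/(16a)`, the function `u(x,t) = a(x)^{-1/4}(F(t − φ(x)) + G(t + φ(x)))`
solves `u_tt − a·u_xx = a'·u_x − c·u` on `I × ℝ`. -/
theorem variable_speed_general_solution
    (I : Set ℝ) (hIopen : IsOpen I) (hIconn : I.OrdConnected)
    (a : ℝ → ℝ) (ha : ContDiffOn ℝ 2 a I) (hapos : ∀ x ∈ I, 0 < a x)
    (φ : ℝ → ℝ) (hφ : ∀ x ∈ I, HasDerivAt φ ((Real.sqrt (a x))⁻¹) x)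
    (c : ℝ → ℝ)
    (hc : ∀ x ∈ I, c x = -(deriv (deriv a) x) / 4 + (deriv a x)^2 / (16 * a x))
    (F G : ℝ → ℝ) (hF : ContDiff ℝ 2 F) (hG : ContDiff ℝ 2 G)
    (u : ℝ × ℝ → ℝ)
    (hu : ∀ x ∈ I, ∀ t : ℝ,
      u (x, t) = (a x) ^ (-(1/4 : ℝ)) * (F (t - φ x) + G (t + φ x))) :
    ∀ x ∈ I, ∀ t : ℝ,
      pt (pt u) (x, t) - a x * px (px u) (x, t) =
        deriv a x * px u (x, t) - c x * u (x, t) := by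
  intro x hx t
  set b : ℝ → ℝ := fun y => a y ^ (-(1/4 : ℝ)) with hb
  have hab : ∀ y ∈ I, a y * b y ^ 4 = 1 := fun y hy => by
    have hy := hapos y hy
    rw [hb, ← Real.rpow_natCast, ← Real.rpow_mul hy.le]
    norm_num [Real.rpow_neg_one, hy.ne']
  have hφb : ∀ y ∈ I, HasDerivAt φ (b y ^ 2) y := fun y hy => by
    convert hφ y hy using 1
    have hy := (hapos y hy).le
    rw [hb, Real.sqrt_eq_rpow, ← Real.rpow_neg hy, ← Real.rpow_natCast, ← Real.rpow_mul hy]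
    norm_num
  have hφn : ∀ y ∈ I, HasDerivAt (fun z => -φ z) (-b y ^ 2) y := fun y hy => (hφb y hy).neg
  have ha1 := fun y hy => (ha.hasDerivAt_and_hasDerivAt_deriv hIopen (x := y) hy).1
  have ha2 := (ha.hasDerivAt_and_hasDerivAt_deriv hIopen hx).2
  have hF' := fun y => hF.contDiffOn.hasDerivAt_and_hasDerivAt_deriv isOpen_univ (Set.mem_univ y)
  have hG' := fun y => hG.contDiffOn.hasDerivAt_and_hasDerivAt_deriv isOpen_univ (Set.mem_univ y)
  set b' : ℝ → ℝ := fun y => -(1/4) * deriv a y * b y ^ 5 with hb'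
  have hbd : ∀ y ∈ I, HasDerivAt b (b' y) y := fun y hy =>
    (ha1 y hy).rpow_neg_quarter (hapos y hy)
  have hb'd : HasDerivAt b'
      (-(1/4) * deriv (deriv a) x * b x ^ 5 + -(1/4) * deriv a x * (5 * b x ^ 4 * b' x)) x := by
    refine ((ha2.const_mul (-(1/4))).mul ((hbd x hx).pow 5)).congr_deriv ?_
    simp
  have hb3 : HasDerivAt (fun y => b y ^ 3) (3 * b x ^ 2 * b' x) x := by
    refine ((hbd x hx).pow 3).congr_deriv ?_
    simp
  have hu1 : ∀ y ∈ I, ∀ s, u (y, s) = b y * F (s + -φ y) + b y * G (s + φ y) := fun y hy s => by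
    rw [hu y hy s, ← sub_eq_add_neg, mul_add]
  have hfirst := fun y hy s => HasFDerivAt.px_pt_eq hIopen hu1 hy
    ((hasFDerivAt_amplitude_mul_profile (t := s) (hbd y hy) (hφn y hy) (hF' _).1).add_fst_snd
      (hasFDerivAt_amplitude_mul_profile (hbd y hy) (hφb y hy) (hG' _).1))
  have hpx : ∀ y ∈ I, ∀ s, px u (y, s) =
      (b' y * F (s + -φ y) + b' y * G (s + φ y)) +
        (-b y ^ 3 * deriv F (s + -φ y) + b y ^ 3 * deriv G (s + φ y)) := fun y hy s => by
    rw [(hfirst y hy s).1]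
    ring
  have hpt := fun y hy s => (hfirst y hy s).2
  have hpxx := (HasFDerivAt.px_pt_eq (t := t) hIopen hpx hx
    (((hasFDerivAt_amplitude_mul_profile hb'd (hφn x hx) (hF' _).1).add_fst_snd
      (hasFDerivAt_amplitude_mul_profile hb'd (hφb x hx) (hG' _).1)).add_fst_snd
    ((hasFDerivAt_amplitude_mul_profile hb3.neg (hφn x hx) (hF' _).2).add_fst_snd
      (hasFDerivAt_amplitude_mul_profile hb3 (hφb x hx) (hG' _).2)))).1
  have hptt := (HasFDerivAt.px_pt_eq (t := t) hIopen hpt hx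
    ((hasFDerivAt_amplitude_mul_profile (hbd x hx) (hφn x hx) (hF' _).2).add_fst_snd
      (hasFDerivAt_amplitude_mul_profile (hbd x hx) (hφb x hx) (hG' _).2))).2
  have hcx : c x = -(deriv (deriv a) x) / 4 + (deriv a x)^2 * b x ^ 4 / 16 := by
    rw [hc x hx, eq_inv_of_mul_eq_one_right (hab x hx)]
    field_simp
  rw [hpxx, hptt, hpx x hx, hu1 x hx, hcx]
  have hax := hab x hx
  simp only [hb']
  clear_value b
  simp only [Pi.neg_apply]
  generalize F (t + -φ x) = f0, G (t + φ x) = g0, deriv F (t + -φ x) = f1,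
    deriv G (t + φ x) = g1, deriv (deriv F) (t + -φ x) = f2, deriv (deriv G) (t + φ x) = g2,
    deriv (deriv a) x = a2, deriv a x = a1, b x = β, a x = α at *
  grind
end

section
/- Let c₀ > 0. Then for all twice continuously differentiable F, G : ℝ → ℝ, the function u(x,t) = x^{-1/3}·( F(t + (3/√c₀)·x^{1/3}) + G(t − (3/√c₀)·x^{1/3}) ) satisfies the equation u_tt = ∂_x( c₀·x^{4/3}·u_x ), i.e. u_tt = c₀·x^{4/3}·u_xx + (4/3)·c₀·x^{1/3}·u_x, at every point (x,t) with x > 0. -/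
theorem px_eq_of_hasDerivAt {u : ℝ × ℝ → ℝ} {x t d : ℝ} (hu : DifferentiableAt ℝ u (x, t))
    (hd : HasDerivAt (fun s => u (s, t)) d x) : px u (x, t) = d :=
  (hu.hasFDerivAt.comp_hasDerivAt x ((hasDerivAt_id x).prodMk (hasDerivAt_const x t))).unique hd

theorem pt_eq_of_hasDerivAt {u : ℝ × ℝ → ℝ} {x t d : ℝ} (hu : DifferentiableAt ℝ u (x, t))
    (hd : HasDerivAt (fun s => u (x, s)) d t) : pt u (x, t) = d :=
  (hu.hasFDerivAt.comp_hasDerivAt t ((hasDerivAt_const t x).prodMk (hasDerivAt_id t))).unique hd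

theorem ContDiffAt.differentiableAt_px {u : ℝ × ℝ → ℝ} {p : ℝ × ℝ} (hu : ContDiffAt ℝ 2 u p) :
    DifferentiableAt ℝ (px u) p :=
  ((hu.fderiv_right (m := 1) (by norm_num)).differentiableAt (by norm_num)).clm_apply
    (differentiableAt_const _)

theorem ContDiffAt.differentiableAt_pt {u : ℝ × ℝ → ℝ} {p : ℝ × ℝ} (hu : ContDiffAt ℝ 2 u p) :
    DifferentiableAt ℝ (pt u) p :=
  ((hu.fderiv_right (m := 1) (by norm_num)).differentiableAt (by norm_num)).clm_apply
    (differentiableAt_const _)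

theorem ContDiff.hasDerivAt_deriv_deriv {F : ℝ → ℝ} (hF : ContDiff ℝ 2 F) (y : ℝ) :
    HasDerivAt (deriv F) (deriv (deriv F) y) y := by
  have h : ContDiff ℝ (1 + 1) F := by simpa [one_add_one_eq_two] using hF
  exact (((contDiff_succ_iff_deriv.1 h).2.2).differentiable (by norm_num) y).hasDerivAt

/-- For `c₀ > 0`, the function
`u(x,t) = x^{-1/3}(F(t + (3/√c₀)x^{1/3}) + G(t − (3/√c₀)x^{1/3}))` solves
`u_tt = c₀x^{4/3}u_xx + (4/3)c₀x^{1/3}u_x` for `x > 0`. -/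
theorem power_law_speed_general_solution
    (c₀ : ℝ) (hc₀ : 0 < c₀)
    (F G : ℝ → ℝ) (hF : ContDiff ℝ 2 F) (hG : ContDiff ℝ 2 G)
    (u : ℝ × ℝ → ℝ)
    (hu : ∀ x t : ℝ, 0 < x →
      u (x, t) = x ^ (-(1/3 : ℝ)) *
        (F (t + (3 / Real.sqrt c₀) * x ^ ((1:ℝ)/3))
          + G (t - (3 / Real.sqrt c₀) * x ^ ((1:ℝ)/3)))) :
    ∀ x t : ℝ, 0 < x →
      pt (pt u) (x, t) =
        c₀ * x ^ ((4:ℝ)/3) * px (px u) (x, t)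
          + (4/3) * c₀ * x ^ ((1:ℝ)/3) * px u (x, t) := by
  set k : ℝ := 3 / Real.sqrt c₀ with hk
  have hck : c₀ * k ^ 2 = 9 := by
    rw [hk, div_pow, Real.sq_sqrt hc₀.le]
    field_simp
    norm_num
  have hF1 (y : ℝ) : HasDerivAt F (deriv F y) y :=
    (hF.differentiable (by norm_num) y).hasDerivAt
  have hG1 (y : ℝ) : HasDerivAt G (deriv G y) y :=
    (hG.differentiable (by norm_num) y).hasDerivAt
  have hF2 := hF.hasDerivAt_deriv_deriv
  have hG2 := hG.hasDerivAt_deriv_deriv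
  have hpos {x : ℝ} (hx : 0 < x) : ∀ᶠ s in nhds x, 0 < s := eventually_gt_nhds hx
  have hC (x t : ℝ) (hx : 0 < x) : ContDiffAt ℝ 2 u (x, t) := by
    have h1 (r : ℝ) : ContDiffAt ℝ 2 (fun p : ℝ × ℝ => p.1 ^ r) (x, t) :=
      contDiffAt_fst.rpow_const_of_ne hx.ne'
    have h2 : ContDiffAt ℝ 2 (fun p : ℝ × ℝ => p.1 ^ (-(1/3 : ℝ)) *
        (F (p.2 + k * p.1 ^ ((1:ℝ)/3)) + G (p.2 - k * p.1 ^ ((1:ℝ)/3)))) (x, t) :=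
      (h1 _).mul
        ((hF.contDiffAt.comp (x, t) (contDiffAt_snd.add (contDiffAt_const.mul (h1 _)))).add
          (hG.contDiffAt.comp (x, t) (contDiffAt_snd.sub (contDiffAt_const.mul (h1 _)))))
    refine h2.congr_of_eventuallyEq ?_
    filter_upwards [continuous_fst.continuousAt.eventually (hpos hx)] with p hp
    exact hu p.1 p.2 hp
  have hplus (t : ℝ) {x : ℝ} (hx : 0 < x) : HasDerivAt (fun s : ℝ => t + k * s ^ ((1:ℝ)/3))
      (k * ((1/3) * x ^ (-(2/3) : ℝ))) x := by
    have h := ((Real.hasDerivAt_rpow_const (p := (1:ℝ)/3) (Or.inl hx.ne')).const_mul k).const_add t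
    norm_num at h ⊢
    exact h
  have hminus (t : ℝ) {x : ℝ} (hx : 0 < x) : HasDerivAt (fun s : ℝ => t - k * s ^ ((1:ℝ)/3))
      (-(k * ((1/3) * x ^ (-(2/3) : ℝ)))) x := by
    have h := ((Real.hasDerivAt_rpow_const (p := (1:ℝ)/3) (Or.inl hx.ne')).const_mul k).const_sub t
    norm_num at h ⊢
    exact h
  have hpow (r : ℝ) {x : ℝ} (hx : 0 < x) : HasDerivAt (fun s : ℝ => s ^ r) (r * x ^ (r - 1)) x :=
    Real.hasDerivAt_rpow_const (Or.inl hx.ne')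
  have hpt (x t : ℝ) (hx : 0 < x) : pt u (x, t) = x ^ (-(1/3 : ℝ)) *
      (deriv F (t + k * x ^ ((1:ℝ)/3)) + deriv G (t - k * x ^ ((1:ℝ)/3))) := by
    refine pt_eq_of_hasDerivAt ((hC x t hx).differentiableAt (by norm_num)) ?_
    simp only [hu x _ hx]
    exact (((hF1 _).comp_add_const t _).add ((hG1 _).comp_sub_const t _)).const_mul _
  have hptt (x t : ℝ) (hx : 0 < x) : pt (pt u) (x, t) = x ^ (-(1/3 : ℝ)) *
      (deriv (deriv F) (t + k * x ^ ((1:ℝ)/3)) + deriv (deriv G) (t - k * x ^ ((1:ℝ)/3))) := by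
    refine pt_eq_of_hasDerivAt (hC x t hx).differentiableAt_pt ?_
    simp only [hpt x _ hx]
    exact (((hF2 _).comp_add_const t _).add ((hG2 _).comp_sub_const t _)).const_mul _
  have hpx (x t : ℝ) (hx : 0 < x) : px u (x, t) =
      -(1/3) * x ^ (-(4/3) : ℝ) * (F (t + k * x ^ ((1:ℝ)/3)) + G (t - k * x ^ ((1:ℝ)/3))) +
      k / 3 * x ^ (-1 : ℝ) *
        (deriv F (t + k * x ^ ((1:ℝ)/3)) - deriv G (t - k * x ^ ((1:ℝ)/3))) := by
    refine px_eq_of_hasDerivAt ((hC x t hx).differentiableAt (by norm_num)) ?_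
    have h := (hpow (-(1/3)) hx).mul
      (((hF1 _).comp x (hplus t hx)).add ((hG1 _).comp x (hminus t hx)))
    refine (h.congr_of_eventuallyEq ((hpos hx).mono fun s hs => hu s t hs)).congr_deriv ?_
    have e1 : x ^ (-(1/3) - 1 : ℝ) = x ^ (-(4/3) : ℝ) := by norm_num
    have e2 : x ^ (-1 : ℝ) = x ^ (-(1/3) : ℝ) * x ^ (-(2/3) : ℝ) := by
      rw [← Real.rpow_add hx]; norm_num
    simp only [Pi.add_apply, Function.comp_apply]
    rw [e1, e2]
    ring
  intro x t hx
  have h := (((hpow (-(4/3)) hx).const_mul (-(1/3))).mul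
    (((hF1 _).comp x (hplus t hx)).add ((hG1 _).comp x (hminus t hx)))).add
    (((hpow (-1) hx).const_mul (k / 3)).mul
    (((hF2 _).comp x (hplus t hx)).sub ((hG2 _).comp x (hminus t hx))))
  have hpxx := px_eq_of_hasDerivAt (hC x t hx).differentiableAt_px
    (h.congr_of_eventuallyEq ((hpos hx).mono fun s hs => hpx s t hs))
  rw [hptt x t hx, hpxx, hpx x t hx]
  simp only [Pi.add_apply, Pi.sub_apply, Function.comp_apply]
  set y : ℝ := x ^ ((1:ℝ)/3) with hy
  have hy0 : 0 < y := Real.rpow_pos_of_pos hx _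
  have hyz (r : ℝ) (n : ℤ) (h : r = n / 3) : x ^ r = y ^ n := by
    rw [hy, ← Real.rpow_intCast, ← Real.rpow_mul hx.le, h]
    congr 1
    ring
  rw [hyz (4/3) 4 (by norm_num), hyz (-(1/3)) (-1) (by norm_num),
    hyz (-(4/3)) (-4) (by norm_num), hyz (-(4/3) - 1) (-7) (by norm_num),
    hyz (-(2/3)) (-2) (by norm_num), hyz (-1 - 1) (-6) (by norm_num),
    hyz (-1) (-3) (by norm_num)]
  have hk0 : k ≠ 0 := by rintro h; norm_num [h] at hck
  have hc : c₀ = 9 / k ^ 2 := by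
    rw [← hck]
    field_simp
  clear_value k y
  subst hc
  field_simp
  ring
end

section
/- Let c₀ ∈ ℝ and define k₀ = c₀/2 − c₀²/4. Then for all twice continuously differentiable F, G : ℝ → ℝ, the function u(x,t) = x^{−c₀/2}·( F(x + t) + G(x − t) ) satisfies the Klein–Gordon–Fock equation with central symmetry u_tt = u_xx + (c₀/x)·u_x − (k₀/x²)·u at every point (x,t) with x > 0. -/
open Topology Filter

/-- The travelling-wave ansatz `x ^ a * (A (x + t) + B (x - t))`. -/
noncomputable def weightedWave (a : ℝ) (A B : ℝ → ℝ) (p : ℝ × ℝ) : ℝ :=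
  p.1 ^ a * (A (p.1 + p.2) + B (p.1 - p.2))

theorem hasFDerivAt_weightedWave (a : ℝ) {A B : ℝ → ℝ} (hA : Differentiable ℝ A)
    (hB : Differentiable ℝ B) {p : ℝ × ℝ} (hp : 0 < p.1) :
    HasFDerivAt (weightedWave a A B)
      ((a * weightedWave (a - 1) A B p + weightedWave a (deriv A) (deriv B) p) •
          ContinuousLinearMap.fst ℝ ℝ ℝ +
        weightedWave a (deriv A) (-deriv B) p • ContinuousLinearMap.snd ℝ ℝ ℝ) p := by
  have h1 : HasFDerivAt (fun q : ℝ × ℝ => q.1) (ContinuousLinearMap.fst ℝ ℝ ℝ) p :=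
    hasFDerivAt_fst
  have h2 : HasFDerivAt (fun q : ℝ × ℝ => q.2) (ContinuousLinearMap.snd ℝ ℝ ℝ) p :=
    hasFDerivAt_snd
  have hpow := (Real.hasDerivAt_rpow_const (p := a) (Or.inl hp.ne')).comp_hasFDerivAt p h1
  have hA' := (hA (p.1 + p.2)).hasDerivAt.comp_hasFDerivAt p (h1.add h2)
  have hB' := (hB (p.1 - p.2)).hasDerivAt.comp_hasFDerivAt p (h1.sub h2)
  refine (hpow.mul (hA'.add hB')).congr_fderiv ?_
  ext <;> simp [weightedWave] <;> ring

theorem px_weightedWave (a : ℝ) {A B : ℝ → ℝ} (hA : Differentiable ℝ A)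
    (hB : Differentiable ℝ B) {p : ℝ × ℝ} (hp : 0 < p.1) :
    px (weightedWave a A B) p =
      a * weightedWave (a - 1) A B p + weightedWave a (deriv A) (deriv B) p := by
  simp [px, (hasFDerivAt_weightedWave a hA hB hp).fderiv]

theorem pt_weightedWave (a : ℝ) {A B : ℝ → ℝ} (hA : Differentiable ℝ A)
    (hB : Differentiable ℝ B) {p : ℝ × ℝ} (hp : 0 < p.1) :
    pt (weightedWave a A B) p = weightedWave a (deriv A) (-deriv B) p := by
  simp [pt, (hasFDerivAt_weightedWave a hA hB hp).fderiv]

theorem px_congr_of_pos {u v : ℝ × ℝ → ℝ} (h : ∀ p : ℝ × ℝ, 0 < p.1 → u p = v p)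
    {p : ℝ × ℝ} (hp : 0 < p.1) : px u p = px v p := by
  have h' : u =ᶠ[𝓝 p] v := (continuousAt_fst.eventually_const_lt hp).mono h
  simp [px, h'.fderiv_eq]

theorem pt_congr_of_pos {u v : ℝ × ℝ → ℝ} (h : ∀ p : ℝ × ℝ, 0 < p.1 → u p = v p)
    {p : ℝ × ℝ} (hp : 0 < p.1) : pt u p = pt v p := by
  have h' : u =ᶠ[𝓝 p] v := (continuousAt_fst.eventually_const_lt hp).mono h
  simp [pt, h'.fderiv_eq]

/-- With `k₀ = c₀/2 − c₀²/4`, the function `u(x,t) = x^{−c₀/2}(F(x + t) + G(x − t))`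
solves the Klein–Gordon–Fock equation `u_tt = u_xx + (c₀/x)u_x − (k₀/x²)u` for `x > 0`. -/
theorem KGF_central_symmetry_general_solution
    (c₀ k₀ : ℝ) (hk₀ : k₀ = c₀ / 2 - c₀^2 / 4)
    (F G : ℝ → ℝ) (hF : ContDiff ℝ 2 F) (hG : ContDiff ℝ 2 G)
    (u : ℝ × ℝ → ℝ)
    (hu : ∀ x t : ℝ, 0 < x →
      u (x, t) = x ^ (-(c₀ / 2)) * (F (x + t) + G (x - t))) :
    ∀ x t : ℝ, 0 < x →
      pt (pt u) (x, t) =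
        px (px u) (x, t) + (c₀ / x) * px u (x, t) - (k₀ / x^2) * u (x, t) := by
  intro x t hx
  have hF₀ : Differentiable ℝ F := hF.differentiable (by norm_num)
  have hG₀ : Differentiable ℝ G := hG.differentiable (by norm_num)
  have hF₁ : Differentiable ℝ (deriv F) := hF.differentiable_deriv_two
  have hG₁ : Differentiable ℝ (deriv G) := hG.differentiable_deriv_two
  set a : ℝ := -(c₀ / 2) with ha
  have hu' : ∀ p : ℝ × ℝ, 0 < p.1 → u p = weightedWave a F G p := fun p hp => hu p.1 p.2 hp
  have hpx : ∀ p : ℝ × ℝ, 0 < p.1 → px u p =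
      a * weightedWave (a - 1) F G p + weightedWave a (deriv F) (deriv G) p := fun p hp =>
    (px_congr_of_pos hu' hp).trans (px_weightedWave a hF₀ hG₀ hp)
  have hpt : ∀ p : ℝ × ℝ, 0 < p.1 → pt u p = weightedWave a (deriv F) (-deriv G) p :=
    fun p hp => (pt_congr_of_pos hu' hp).trans (pt_weightedWave a hF₀ hG₀ hp)
  have hp : 0 < ((x, t) : ℝ × ℝ).1 := hx
  have hptt := (pt_congr_of_pos hpt hp).trans (pt_weightedWave a hF₁ hG₁.neg hp)
  have hpxx : px (px u) (x, t) =
      a * px (weightedWave (a - 1) F G) (x, t) +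
        px (weightedWave a (deriv F) (deriv G)) (x, t) := by
    have h₁ := (hasFDerivAt_weightedWave (a - 1) hF₀ hG₀ hp).differentiableAt
    have h₂ := (hasFDerivAt_weightedWave a hF₁ hG₁ hp).differentiableAt
    rw [px_congr_of_pos hpx hp]
    simp only [px]
    rw [((h₁.hasFDerivAt.const_mul a).fun_add h₂.hasFDerivAt).fderiv]
    simp
  rw [px_weightedWave _ hF₀ hG₀ hp, px_weightedWave _ hF₁ hG₁ hp] at hpxx
  have hneg : deriv (-deriv G) = -deriv (deriv G) := deriv.neg'
  rw [hptt, hpxx, hpx _ hp, hu' _ hp, hneg, neg_neg, hk₀]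
  have hc : c₀ = -2 * a := by rw [ha]; ring
  simp only [weightedWave, Real.rpow_sub_one hx.ne', hc]
  field_simp
  ring
end
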